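/- Let (k, pk, val) be a key-update sequence over a type V, let K : ℕ, let w : V, and suppose that at some index m we have k m ≥ K and val m = w. Then for every i ≥ m, either pk i ≥ K, or both k i ≥ K and val i = w. (This is the inductive core of Lemma 'goodKeySupport' of IT-HS: if some nonfaulty party set key3 = K with value w in view K, then each of the f + 1 nonfaulty parties that sent the corresponding key2 message keeps, in every later view, either prev_key2 ≥ K, or key2 ≥ K with key2_val = w, so their suggest messages forever support the pair (K, w).) -/

import Mathlib

/-- A key-update sequence over a type `V`, modeling a party's updates of a key
field `k`, previous-key field `pk`, and key value `val` in IT-HS. At each step,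
either nothing changes, or `k` increases keeping `pk` and `val`, or `k`
increases, `pk` becomes the old `k`, and `val` changes. -/
structure KeyUpdateSeq (V : Type*) where
  k : ℕ → ℕ
  pk : ℕ → ℕ
  val : ℕ → V
  init : pk 0 < k 0
  step : ∀ i,
    (k (i + 1) = k i ∧ pk (i + 1) = pk i ∧ val (i + 1) = val i) ∨
    (k (i + 1) > k i ∧ pk (i + 1) = pk i ∧ val (i + 1) = val i) ∨
    (k (i + 1) > k i ∧ pk (i + 1) = k i ∧ val (i + 1) ≠ val i)

theorem KeyUpdateSeq.pk_lt_k {V : Type*} (s : KeyUpdateSeq V) (i : ℕ) : s.pk i < s.k i := by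
  induction i with
  | zero => exact s.init
  | succ i ih => rcases s.step i with h | h | h <;> omega

/-- Inductive core of Lemma goodKeySupport: if at index `m` we have
`k m ≥ K` and `val m = w`, then forever after either `pk ≥ K`, or
`k ≥ K` with value `w`. -/
theorem goodKeySupport_invariant {V : Type*} (s : KeyUpdateSeq V)
    (K : ℕ) (w : V) (m : ℕ) (hk : s.k m ≥ K) (hv : s.val m = w) :
    ∀ i, m ≤ i → s.pk i ≥ K ∨ (s.k i ≥ K ∧ s.val i = w) := by
  intro i hi
  induction i, hi using Nat.le_induction with
  | base => exact Or.inr ⟨hk, hv⟩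
  | succ i _ ih =>
    have hlt := s.pk_lt_k i
    rcases s.step i with ⟨h1, h2, h3⟩ | ⟨h1, h2, h3⟩ | ⟨h1, h2, -⟩
    · rwa [h1, h2, h3]
    · rw [h2, h3]
      exact ih.imp_right fun h => ⟨h.1.trans h1.le, h.2⟩
    · left
      rcases ih with h | ⟨h, -⟩ <;> omega
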